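/- There exists σ1 ≥ 2(1−p)/(m−1) such that for every σ ∈ (σ1, ∞): no good profile with interface has behavior (B1) or (B2) at the origin; consequently, every good profile with interface (of either Type) has behavior (B3) at the origin. -/

import Mathlib

open Real Filter Set Topology

noncomputable def alphaC (m p σ : ℝ) : ℝ := (σ + 2) / (σ * (m - 1) + 2 * (p - 1))

noncomputable def betaC (m p σ : ℝ) : ℝ := (m - p) / (σ * (m - 1) + 2 * (p - 1))

/-- The self-similar profile ODE (SSODE) at the point `ξ`. -/
def SSODE (N : ℕ) (m p σ : ℝ) (f : ℝ → ℝ) (ξ : ℝ) : Prop :=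
  deriv (deriv fun x => f x ^ m) ξ + ((N : ℝ) - 1) / ξ * deriv (fun x => f x ^ m) ξ
    - alphaC m p σ * f ξ + betaC m p σ * ξ * deriv f ξ + ξ ^ σ * f ξ ^ p = 0

/-- `f` is a profile with interface at `ξ0`. -/
def ProfileWithInterface (N : ℕ) (m p σ : ℝ) (f : ℝ → ℝ) (ξ0 : ℝ) : Prop :=
  0 < ξ0 ∧
  ContinuousOn f (Icc 0 ξ0) ∧
  (∀ ξ ∈ Ioo 0 ξ0, 0 < f ξ) ∧
  ContDiffOn ℝ 2 f (Ioo 0 ξ0) ∧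
  (∀ ξ ∈ Ioo 0 ξ0, SSODE N m p σ f ξ) ∧
  f ξ0 = 0 ∧
  Tendsto (fun ξ => deriv (fun x => f x ^ m) ξ) (𝓝[<] ξ0) (𝓝 0)

/-- Interface of Type I: `f(ξ) ~ (ξ0 - ξ)^(1/(m-1))` as `ξ → ξ0⁻`. -/
def TypeI (m : ℝ) (f : ℝ → ℝ) (ξ0 : ℝ) : Prop :=
  ∃ c, 0 < c ∧ Tendsto (fun ξ => f ξ * (ξ0 - ξ) ^ (-(1 / (m - 1)))) (𝓝[<] ξ0) (𝓝 c)

/-- Interface of Type II: `f(ξ) ~ (ξ0 - ξ)^(1/(1-p))` as `ξ → ξ0⁻`. -/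
def TypeII (p : ℝ) (f : ℝ → ℝ) (ξ0 : ℝ) : Prop :=
  ∃ c, 0 < c ∧ Tendsto (fun ξ => f ξ * (ξ0 - ξ) ^ (-(1 / (1 - p)))) (𝓝[<] ξ0) (𝓝 c)

/-- Behavior (B1) at the origin. -/
def BehB1 (N : ℕ) (m p σ : ℝ) (f : ℝ → ℝ) : Prop :=
  0 < f 0 ∧ Tendsto (fun ξ => (f ξ ^ (m - 1) - f 0 ^ (m - 1)) / ξ ^ 2)
    (𝓝[>] 0) (𝓝 (alphaC m p σ * (m - 1) / (2 * m * (N : ℝ))))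

/-- Behavior (B2) at the origin. -/
def BehB2 (N : ℕ) (m : ℝ) (f : ℝ → ℝ) : Prop :=
  f 0 = 0 ∧ Tendsto (fun ξ => f ξ * ξ ^ (-(2 / (m - 1)))) (𝓝[>] 0)
    (𝓝 (((m - 1) / (2 * m * (m * (N : ℝ) - (N : ℝ) + 2))) ^ (1 / (m - 1))))

/-- Behavior (B3) at the origin. -/
def BehB3 (m p σ : ℝ) (f : ℝ → ℝ) : Prop :=
  f 0 = 0 ∧ ∃ K, 0 < K ∧
    Tendsto (fun ξ => f ξ * ξ ^ (-((σ + 2) / (m - p)))) (𝓝[>] 0) (𝓝 K)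

/-- A good profile with interface at `ξ0`. -/
def GoodProfile (N : ℕ) (m p σ : ℝ) (f : ℝ → ℝ) (ξ0 : ℝ) : Prop :=
  ProfileWithInterface N m p σ f ξ0 ∧
  (BehB1 N m p σ f ∨ BehB2 N m f ∨ BehB3 m p σ f)

noncomputable def xiMax (m p σ : ℝ) : ℝ := (betaC m p σ ^ 2 / (4 * m)) ^ (1 / (σ - 2))

theorem mono_aux {F F' : ℝ → ℝ} {x y : ℝ} (hxy : x ≤ y)
    (hd : ∀ t ∈ Icc x y, HasDerivAt F (F' t) t) (h0 : ∀ t ∈ Ioo x y, 0 ≤ F' t) : F x ≤ F y := by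
  have h : MonotoneOn F (Icc x y) := by
    apply monotoneOn_of_deriv_nonneg (convex_Icc x y)
    · exact fun t ht => (hd t ht).continuousAt.continuousWithinAt
    · intro t ht
      rw [interior_Icc] at ht
      exact (hd t (Ioo_subset_Icc_self ht)).differentiableAt.differentiableWithinAt
    · intro t ht
      rw [interior_Icc] at ht
      rw [(hd t (Ioo_subset_Icc_self ht)).deriv]
      exact h0 t ht
  exact h (left_mem_Icc.2 hxy) (right_mem_Icc.2 hxy) hxy

/-- Abstract data for a positive solution on (0, ξ0): derivative f1, flux W of f^m. -/
structure Core (n m p σ a α β ξ0 : ℝ) (f f1 W W1 : ℝ → ℝ) : Prop where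
  hm : 1 < m
  hp0 : 0 < p
  hp1 : p < 1
  hn : 1 ≤ n
  hβ : 0 < β
  hα : α = a * β
  hα1 : 1 / (m - 1) ≤ α
  ha : 2 / (m - 1) < a
  haB : 1 / β = σ - a * (1 - p)
  hξ0 : 0 < ξ0
  pos : ∀ x ∈ Ioo 0 ξ0, 0 < f x
  df : ∀ x ∈ Ioo 0 ξ0, HasDerivAt f (f1 x) x
  dW : ∀ x ∈ Ioo 0 ξ0, HasDerivAt W (W1 x) x
  eqW : ∀ x ∈ Ioo 0 ξ0, W x = m * f x ^ (m - 1) * f1 x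
  ode : ∀ x ∈ Ioo 0 ξ0,
    W1 x + (n - 1) / x * W x - α * f x + β * x * f1 x + x ^ σ * f x ^ p = 0
  fend : Tendsto f (𝓝[<] ξ0) (𝓝 0)
  Wend : Tendsto W (𝓝[<] ξ0) (𝓝 0)
  g0 : Tendsto (fun x => f x * x ^ (-a)) (𝓝[>] 0) atTop
  u0 : ∀ᶠ x in 𝓝[>] (0:ℝ), (m - 1) / (8 * m * ((m - 1) * n + 2)) * x ^ 2 < f x ^ (m - 1)
  W0 : ∀ ε > 0, ∀ δ > 0, ∃ x ∈ Ioo 0 δ, |W x| < ε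
  f0 : ∃ M, ∀ᶠ x in 𝓝[>] (0:ℝ), f x ≤ M

namespace Core
variable {n m p σ a α β ξ0 : ℝ} {f f1 W W1 : ℝ → ℝ}

theorem gmono (h : Core n m p σ a α β ξ0 f f1 W W1) {x y : ℝ} (hx : 0 < x) (hxy : x ≤ y)
    (hy : y < ξ0) : f y * y ^ (-a) ≤ f x * x ^ (-a) := by
  by_contra! hlt
  have hm := h.hm
  have ha0 : 0 < a := lt_trans (by have : 0 < m - 1 := by linarith
                                   positivity) h.ha
  set g : ℝ → ℝ := fun x => f x * x ^ (-a) with hg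
  have dg : ∀ t ∈ Ioo 0 ξ0, HasDerivAt g (t ^ (-a - 1) * (t * f1 t - a * f t)) t := by
    intro t ht
    have h1 := (h.df t ht).mul (Real.hasDerivAt_rpow_const (x := t) (p := -a) (Or.inl ht.1.ne'))
    refine h1.congr_deriv ?_
    have : t ^ (-a) = t ^ (-a - 1) * t := by
      rw [← Real.rpow_add_one ht.1.ne']; congr 1; ring
    rw [this]; ring
  have hxy' : x < y := by
    rcases hxy.lt_or_eq with h1 | h1
    · exact h1
    · subst h1; exact absurd hlt (lt_irrefl _)
  obtain ⟨z, hz, hz0, hzx⟩ : ∃ z, g x < g z ∧ 0 < z ∧ z < x := by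
    have h1 := h.g0.eventually (eventually_gt_atTop (g x))
    have h2 : Ioo 0 x ∈ 𝓝[>] (0:ℝ) := Ioo_mem_nhdsGT hx
    obtain ⟨z, hz⟩ := (h1.and h2).exists
    exact ⟨z, hz.1, hz.2.1, hz.2.2⟩
  have hcont : ContinuousOn g (Icc z y) := fun t ht =>
    (dg t ⟨lt_of_lt_of_le hz0 ht.1, lt_of_le_of_lt ht.2 hy⟩).continuousAt.continuousWithinAt
  obtain ⟨t, ht, hmin⟩ := isCompact_Icc.exists_isMinOn ⟨z, left_mem_Icc.2 (hzx.trans hxy').le⟩ hcont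
  have htx : g t ≤ g x := hmin ⟨hzx.le, hxy⟩
  have htz : z < t := lt_of_le_of_ne ht.1 (by rintro rfl; exact absurd hz (not_lt.2 htx))
  have hty : t < y := lt_of_le_of_ne ht.2 (by rintro rfl; exact absurd hlt (not_lt.2 htx))
  have ht0 : 0 < t := hz0.trans htz
  have htI : t ∈ Ioo 0 ξ0 := ⟨ht0, hty.trans hy⟩
  have hloc : IsLocalMin g t := hmin.isLocalMin (Icc_mem_nhds htz hty)
  have hd0 := hloc.hasDerivAt_eq_zero (dg t htI)
  have hcr : t * f1 t = a * f t := by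
    rcases mul_eq_zero.1 hd0 with h1 | h1
    · exact absurd h1 (Real.rpow_pos_of_pos ht0 _).ne'
    · linarith
  have hft := h.pos t htI
  -- V = x W - a m f^m
  set V : ℝ → ℝ := fun x => x * W x - a * m * f x ^ m with hV
  have hVeq : ∀ x ∈ Ioo 0 ξ0, V x = m * f x ^ (m - 1) * (x * f1 x - a * f x) := by
    intro x hx
    have : f x ^ m = f x ^ (m - 1) * f x := by
      rw [← Real.rpow_add_one (h.pos x hx).ne']; congr 1; ring
    simp only [hV, this, h.eqW x hx]; ring
  have dV : HasDerivAt V ((1 * W t + t * W1 t) - a * m * (f1 t * m * f t ^ (m - 1))) t := by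
    have h1 := (hasDerivAt_id t).mul (h.dW t htI)
    have h2 := ((h.df t htI).rpow_const (p := m) (Or.inl hft.ne')).const_mul (a * m)
    exact h1.sub h2
  have hneg : (1 * W t + t * W1 t) - a * m * (f1 t * m * f t ^ (m - 1)) < 0 := by
    have ho := h.ode t htI
    have hW : t * W t = m * f t ^ (m - 1) * (a * f t) := by rw [h.eqW t htI, ← hcr]; ring
    have hWp : 0 < W t := by
      have : 0 < t * W t := by rw [hW]; have := Real.rpow_pos_of_pos hft (m-1); positivity
      exact pos_of_mul_pos_right this ht0.le
    have e1 : t * W1 t = -(n - 1) * W t - t * (t ^ σ * f t ^ p) := by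
      have : (n - 1) / t * W t * t = (n - 1) * W t := by field_simp
      have hα := h.hα
      have e2 : β * t * f1 t = α * f t := by rw [hα]; linear_combination β * hcr
      linear_combination t * ho - this - t * e2
    have e3 : a * m * (f1 t * m * f t ^ (m - 1)) = a * m * W t := by rw [h.eqW t htI]; ring
    rw [e1, e3]
    have h5 : 0 < t * (t ^ σ * f t ^ p) := by
      have := Real.rpow_pos_of_pos ht0 σ
      have := Real.rpow_pos_of_pos hft p
      positivity
    have h6 : 2 < a * m := by
      have h7 := h.ha
      rw [div_lt_iff₀ (by linarith)] at h7
      nlinarith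
    have h8 : 0 < (n - 1 + a * m - 1) * W t := mul_pos (by linarith [h.hn]) hWp
    nlinarith
  have hV0 : V t = 0 := by rw [hVeq t htI, hcr]; ring
  have hev : ∀ᶠ s in 𝓝[>] t, V s < 0 := by
    have hs := (hasDerivAt_iff_tendsto_slope.1 dV).mono_left
      (nhdsWithin_mono t (fun s (hs : s ∈ Ioi t) => ne_of_gt hs))
    filter_upwards [hs.eventually (eventually_lt_nhds hneg), self_mem_nhdsWithin] with s h1 h2
    rw [slope_def_field, hV0, sub_zero, div_lt_iff₀ (sub_pos.2 h2)] at h1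
    simpa using h1
  obtain ⟨r, hr, hrI⟩ := mem_nhdsGT_iff_exists_Ioo_subset.1 hev
  set r' := (t + min r y) / 2 with hr'
  have hmr : t < min r y := lt_min hr hty
  have h1 : t < r' := by linarith
  have h2 : r' < r := by have := min_le_left r y; linarith
  have h3 : r' < y := by have := min_le_right r y; linarith
  obtain ⟨c, hc, hce⟩ := exists_hasDerivAt_eq_slope g (fun t => t ^ (-a - 1) * (t * f1 t - a * f t))
    h1 (hcont.mono (Icc_subset_Icc htz.le h3.le))
    (fun s hs => dg s ⟨ht0.trans hs.1, (hs.2.trans h3).trans hy⟩)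
  have hcI : c ∈ Ioo 0 ξ0 := ⟨ht0.trans hc.1, (hc.2.trans h3).trans hy⟩
  have hVc : V c < 0 := hrI ⟨hc.1, hc.2.trans h2⟩
  rw [hVeq c hcI] at hVc
  have hA : c * f1 c - a * f c < 0 := by
    by_contra! hcon
    have := Real.rpow_pos_of_pos (h.pos c hcI) (m - 1)
    have : 0 ≤ m * f c ^ (m - 1) * (c * f1 c - a * f c) := by positivity
    linarith
  have hB : c ^ (-a - 1) * (c * f1 c - a * f c) < 0 :=
    mul_neg_of_pos_of_neg (Real.rpow_pos_of_pos hcI.1 _) hA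
  have hge : g t ≤ g r' := hmin ⟨(htz.trans h1).le, h3.le⟩
  have : 0 ≤ (g r' - g t) / (r' - t) := div_nonneg (by linarith) (by linarith)
  linarith

/-- Balance quotient of the linear and reaction terms. -/
noncomputable def Q (n p σ α β : ℝ) (f : ℝ → ℝ) (x : ℝ) : ℝ := (α + n * β) * f x ^ (1 - p) * x ^ (-σ)

/-- Flux. -/
noncomputable def Psi (n β : ℝ) (f W : ℝ → ℝ) (x : ℝ) : ℝ := x ^ (n - 1) * (W x + β * x * f x)

theorem alpha_pos (h : Core n m p σ a α β ξ0 f f1 W W1) : 0 < α :=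
  lt_of_lt_of_le (by have := h.hm; have : 0 < m - 1 := by linarith
                     positivity) h.hα1

theorem ap_pos (h : Core n m p σ a α β ξ0 f f1 W W1) : 0 < α + n * β := by
  have := h.alpha_pos; have := h.hβ; have := h.hn; positivity

theorem Q_pos (h : Core n m p σ a α β ξ0 f f1 W W1) {x : ℝ} (hx : x ∈ Ioo 0 ξ0) :
    0 < Q n p σ α β f x := by
  have := h.ap_pos
  have := Real.rpow_pos_of_pos (h.pos x hx) (1 - p)
  have := Real.rpow_pos_of_pos hx.1 (-σ)
  unfold Q; positivity

theorem Q_eq (h : Core n m p σ a α β ξ0 f f1 W W1) {x : ℝ} (hx : x ∈ Ioo 0 ξ0) :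
    Q n p σ α β f x = (α + n * β) * (f x * x ^ (-a)) ^ (1 - p) * x ^ (-(1 / β)) := by
  unfold Q
  rw [Real.mul_rpow (h.pos x hx).le (Real.rpow_pos_of_pos hx.1 _).le, ← Real.rpow_mul hx.1.le,
    h.haB, mul_assoc, mul_assoc, mul_assoc, ← Real.rpow_add hx.1]
  congr 3; ring

theorem Q_mono (h : Core n m p σ a α β ξ0 f f1 W W1) {x y : ℝ} (hx : 0 < x) (hxy : x ≤ y)
    (hy : y < ξ0) : Q n p σ α β f y * (y / x) ^ (1 / β) ≤ Q n p σ α β f x := by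
  have hy0 : 0 < y := hx.trans_le hxy
  have hxI : x ∈ Ioo 0 ξ0 := ⟨hx, hxy.trans_lt hy⟩
  have hyI : y ∈ Ioo 0 ξ0 := ⟨hy0, hy⟩
  have hap := h.ap_pos
  rw [h.Q_eq hxI, h.Q_eq hyI, Real.div_rpow hy0.le hx.le, Real.rpow_neg hx.le (1 / β),
    Real.rpow_neg hy0.le (1 / β)]
  have h1 := Real.rpow_pos_of_pos hx (1 / β)
  have h2 := Real.rpow_pos_of_pos hy0 (1 / β)
  have h3 : (f y * y ^ (-a)) ^ (1 - p) ≤ (f x * x ^ (-a)) ^ (1 - p) := by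
    apply Real.rpow_le_rpow _ (h.gmono hx hxy hy) (by linarith [h.hp1])
    have := h.pos y hyI
    have := Real.rpow_pos_of_pos hy0 (-a)
    positivity
  have e : (α + n * β) * (f y * y ^ (-a)) ^ (1 - p) * (y ^ (1 / β))⁻¹ * (y ^ (1 / β) / x ^ (1 / β))
      = (α + n * β) * (f y * y ^ (-a)) ^ (1 - p) * (x ^ (1 / β))⁻¹ := by
    field_simp
  rw [e]
  gcongr

theorem Q_anti (h : Core n m p σ a α β ξ0 f f1 W W1) {x y : ℝ} (hx : 0 < x) (hxy : x ≤ y)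
    (hy : y < ξ0) : Q n p σ α β f y ≤ Q n p σ α β f x := by
  refine le_trans ?_ (h.Q_mono hx hxy hy)
  apply le_mul_of_one_le_right (h.Q_pos ⟨hx.trans_le hxy, hy⟩).le
  apply Real.one_le_rpow
  · rw [le_div_iff₀ hx]; linarith
  · have := h.hβ; positivity

theorem Q_rel (h : Core n m p σ a α β ξ0 f f1 W W1) {x : ℝ} (hx : x ∈ Ioo 0 ξ0) :
    x ^ σ * f x ^ p * Q n p σ α β f x = (α + n * β) * f x := by
  unfold Q
  have e1 : x ^ σ * x ^ (-σ) = 1 := by rw [← Real.rpow_add hx.1]; simp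
  have e2 : f x ^ p * f x ^ (1 - p) = f x := by rw [← Real.rpow_add (h.pos x hx)]; simp
  calc _ = (x ^ σ * x ^ (-σ)) * (f x ^ p * f x ^ (1 - p)) * (α + n * β) := by ring
    _ = _ := by rw [e1, e2]; ring

theorem dPsi (h : Core n m p σ a α β ξ0 f f1 W W1) {x : ℝ} (hx : x ∈ Ioo 0 ξ0) :
    HasDerivAt (Psi n β f W) (x ^ (n - 1) * ((α + n * β) * f x - x ^ σ * f x ^ p)) x := by
  have h1 := (Real.hasDerivAt_rpow_const (x := x) (p := n - 1) (Or.inl hx.1.ne')).mul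
    ((h.dW x hx).add (((hasDerivAt_id x).const_mul β).mul (h.df x hx)))
  refine h1.congr_deriv ?_
  have e : x ^ (n - 1) = x ^ (n - 1 - 1) * x := by
    rw [← Real.rpow_add_one hx.1.ne']; congr 1; ring
  have ho := h.ode x hx
  have e2 : (n - 1) / x * W x * x = (n - 1) * W x := by have := hx.1; field_simp
  simp only [id, Pi.mul_apply, Pi.add_apply]
  rw [e]
  linear_combination x ^ (n - 1 - 1) * x * ho - x ^ (n - 1 - 1) * e2

theorem du (h : Core n m p σ a α β ξ0 f f1 W W1) {x : ℝ} (hx : x ∈ Ioo 0 ξ0) :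
    HasDerivAt (fun x => f x ^ (m - 1)) ((m - 1) * f x ^ (m - 2) * f1 x) x := by
  have h1 := (h.df x hx).rpow_const (p := m - 1) (Or.inl (h.pos x hx).ne')
  refine h1.congr_deriv ?_
  rw [show m - 1 - 1 = m - 2 by ring]; ring

theorem Psi_eq (h : Core n m p σ a α β ξ0 f f1 W W1) {x : ℝ} (hx : x ∈ Ioo 0 ξ0) :
    Psi n β f W x = x ^ (n - 1) * f x * (m / (m - 1)) *
      ((m - 1) * f x ^ (m - 2) * f1 x + 2 * ((m - 1) * β / (2 * m)) * x) := by
  unfold Psi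
  rw [h.eqW x hx]
  have e : f x ^ (m - 1) = f x ^ (m - 2) * f x := by
    rw [← Real.rpow_add_one (h.pos x hx).ne']; congr 1; ring
  have := h.hm
  have : m - 1 ≠ 0 := by linarith
  rw [e]; field_simp

theorem Psi0 (h : Core n m p σ a α β ξ0 f f1 W W1) : 
    ∀ ε > 0, ∀ δ > 0, ∃ x ∈ Ioo 0 δ, |Psi n β f W x| < ε := by
  intro ε hε δ hδ
  obtain ⟨M, hM⟩ := h.f0
  obtain ⟨r, hr, hrI⟩ := mem_nhdsGT_iff_exists_Ioo_subset.1 hM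
  have hβ := h.hβ
  set d := min (min δ r) (min (min 1 ξ0) (ε / (2 * β * (|M| + 1)))) with hd
  have hr : 0 < r := hr
  have hd0 : 0 < d := by
    have := h.hξ0
    have h3 : 0 < ε / (2 * β * (|M| + 1)) := by positivity
    simp only [hd, lt_min_iff]; exact ⟨⟨hδ, hr⟩, ⟨⟨one_pos, this⟩, h3⟩⟩
  obtain ⟨x, hx, hxW⟩ := h.W0 (ε / 2) (by linarith) d hd0
  have hx2 := hx.2
  simp only [hd, lt_min_iff] at hx2
  obtain ⟨⟨h1, h2⟩, ⟨h3, h4⟩, h5⟩ := hx2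
  refine ⟨x, ⟨hx.1, h1⟩, ?_⟩
  have hfx : f x ≤ M := hrI ⟨hx.1, h2⟩
  have hfp := h.pos x ⟨hx.1, h4⟩
  have hx0 := hx.1
  unfold Psi
  have hpw : x ^ (n - 1) ≤ 1 := Real.rpow_le_one hx.1.le h3.le (by linarith [h.hn])
  have hpw0 := Real.rpow_pos_of_pos hx.1 (n - 1)
  rw [abs_mul, abs_of_pos hpw0]
  have h6 : |W x + β * x * f x| < ε := by
    have h7 : |β * x * f x| ≤ ε / 2 := by
      rw [abs_of_pos (by positivity)]
      rw [lt_div_iff₀ (by positivity)] at h5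
      have : f x ≤ |M| + 1 := by linarith [le_abs_self M]
      have : β * x * f x ≤ β * x * (|M| + 1) := by gcongr
      linarith
    have := abs_add_le (W x) (β * x * f x)
    linarith
  calc _ ≤ 1 * |W x + β * x * f x| := by gcongr
    _ < ε := by linarith

theorem Psi_end (h : Core n m p σ a α β ξ0 f f1 W W1) : Tendsto (Psi n β f W) (𝓝[<] ξ0) (𝓝 0) := by
  have h1 : Tendsto (fun x : ℝ => x ^ (n - 1)) (𝓝[<] ξ0) (𝓝 (ξ0 ^ (n - 1))) :=
    ((Real.continuousAt_rpow_const ξ0 (n - 1) (Or.inl h.hξ0.ne')).tendsto).mono_left nhdsWithin_le_nhds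
  have h2 : Tendsto (fun x : ℝ => β * x) (𝓝[<] ξ0) (𝓝 (β * ξ0)) :=
    ((continuous_const.mul continuous_id).tendsto ξ0).mono_left nhdsWithin_le_nhds
  have := h1.mul (h.Wend.add (h2.mul h.fend))
  simp only [mul_zero, add_zero] at this
  exact this

theorem Psi_ge (h : Core n m p σ a α β ξ0 f f1 W W1) {G G' : ℝ → ℝ} {x : ℝ} (hx : x ∈ Ioo 0 ξ0)
    (hG : ∀ t ∈ Ioc 0 x, HasDerivAt G (G' t) t)
    (hle : ∀ t ∈ Ioo 0 x, G' t ≤ t ^ (n - 1) * ((α + n * β) * f t - t ^ σ * f t ^ p))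
    (hG0 : Tendsto G (𝓝[>] 0) (𝓝 0)) : G x ≤ Psi n β f W x := by
  by_contra! hlt
  set ε := (G x - Psi n β f W x) / 2 with hε
  have hε0 : 0 < ε := by linarith
  have hev := hG0.eventually (gt_mem_nhds hε0)
  obtain ⟨r, hr, hrI⟩ := mem_nhdsGT_iff_exists_Ioo_subset.1 hev
  have hr : 0 < r := hr
  obtain ⟨y, hy, hyP⟩ := h.Psi0 ε hε0 (min r x) (lt_min hr hx.1)
  have hyr : y < r := hy.2.trans_le (min_le_left _ _)
  have hyx : y < x := hy.2.trans_le (min_le_right _ _)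
  have hGy : G y < ε := hrI ⟨hy.1, hyr⟩
  have := mono_aux (F := fun t => Psi n β f W t - G t)
    (F' := fun t => t ^ (n - 1) * ((α + n * β) * f t - t ^ σ * f t ^ p) - G' t) hyx.le
    (fun t ht => (h.dPsi ⟨hy.1.trans_le ht.1, ht.2.trans_lt hx.2⟩).sub
      (hG t ⟨hy.1.trans_le ht.1, ht.2⟩))
    (fun t ht => sub_nonneg.2 (hle t ⟨hy.1.trans ht.1, ht.2⟩))
  have h3 := (abs_lt.1 hyP).1
  linarith

theorem Psi_le (h : Core n m p σ a α β ξ0 f f1 W W1) {G G' : ℝ → ℝ} {x : ℝ} (hx : x ∈ Ioo 0 ξ0)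
    (hG : ∀ t ∈ Ioc 0 x, HasDerivAt G (G' t) t)
    (hle : ∀ t ∈ Ioo 0 x, t ^ (n - 1) * ((α + n * β) * f t - t ^ σ * f t ^ p) ≤ G' t)
    (hG0 : Tendsto G (𝓝[>] 0) (𝓝 0)) : Psi n β f W x ≤ G x := by
  by_contra! hlt
  set ε := (Psi n β f W x - G x) / 2 with hε
  have hε0 : 0 < ε := by linarith
  have hev := hG0.eventually (lt_mem_nhds (neg_lt_zero.2 hε0))
  obtain ⟨r, hr, hrI⟩ := mem_nhdsGT_iff_exists_Ioo_subset.1 hev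
  have hr : 0 < r := hr
  obtain ⟨y, hy, hyP⟩ := h.Psi0 ε hε0 (min r x) (lt_min hr hx.1)
  have hyr : y < r := hy.2.trans_le (min_le_left _ _)
  have hyx : y < x := hy.2.trans_le (min_le_right _ _)
  have hGy : -ε < G y := hrI ⟨hy.1, hyr⟩
  have := mono_aux (F := fun t => G t - Psi n β f W t)
    (F' := fun t => G' t - t ^ (n - 1) * ((α + n * β) * f t - t ^ σ * f t ^ p)) hyx.le
    (fun t ht => (hG t ⟨hy.1.trans_le ht.1, ht.2⟩).sub
      (h.dPsi ⟨hy.1.trans_le ht.1, ht.2.trans_lt hx.2⟩))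
    (fun t ht => sub_nonneg.2 (hle t ⟨hy.1.trans ht.1, ht.2⟩))
  have h3 := (abs_lt.1 hyP).2
  linarith

theorem dPsi_eq (h : Core n m p σ a α β ξ0 f f1 W W1) {x : ℝ} (hx : x ∈ Ioo 0 ξ0) :
    x ^ (n - 1) * ((α + n * β) * f x - x ^ σ * f x ^ p) =
      x ^ (n - 1) * (x ^ σ * f x ^ p) * (Q n p σ α β f x - 1) := by
  rw [← h.Q_rel hx]; ring

theorem coef_pos (h : Core n m p σ a α β ξ0 f f1 W W1) {x : ℝ} (hx : x ∈ Ioo 0 ξ0) :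
    0 < x ^ (n - 1) * (x ^ σ * f x ^ p) := by
  have := Real.rpow_pos_of_pos hx.1 (n - 1)
  have := Real.rpow_pos_of_pos hx.1 σ
  have := Real.rpow_pos_of_pos (h.pos x hx) p
  positivity

theorem Psi_nonneg_of (h : Core n m p σ a α β ξ0 f f1 W W1) {x : ℝ} (hx : x ∈ Ioo 0 ξ0)
    (hQ : ∀ t ∈ Ioo 0 x, 1 ≤ Q n p σ α β f t) : 0 ≤ Psi n β f W x := by
  refine h.Psi_ge (G := fun _ => 0) (G' := fun _ => 0) hx (fun t _ => hasDerivAt_const t 0) ?_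
    tendsto_const_nhds
  intro t ht
  have htI : t ∈ Ioo 0 ξ0 := ⟨ht.1, ht.2.trans hx.2⟩
  rw [h.dPsi_eq htI]
  exact mul_nonneg (h.coef_pos htI).le (by linarith [hQ t ht])

theorem exists_star (h : Core n m p σ a α β ξ0 f f1 W W1) :
    ∃ s ∈ Ioo 0 ξ0, Q n p σ α β f s = 1 := by
  have hξ := h.hξ0
  have hβ := h.hβ
  by_cases hall : ∀ x ∈ Ioo 0 ξ0, 1 ≤ Q n p σ α β f x
  · have hz : ∀ x ∈ Ioo 0 ξ0, Psi n β f W x = 0 := by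
      intro x hx
      apply le_antisymm
      · apply ge_of_tendsto h.Psi_end
        filter_upwards [Ioo_mem_nhdsLT hx.2] with y hy
        apply mono_aux (F' := fun t => t ^ (n - 1) * ((α + n * β) * f t - t ^ σ * f t ^ p)) hy.1.le
        · exact fun t ht => h.dPsi ⟨hx.1.trans_le ht.1, ht.2.trans_lt hy.2⟩
        · intro t ht
          have htI : t ∈ Ioo 0 ξ0 := ⟨hx.1.trans ht.1, ht.2.trans hy.2⟩
          rw [h.dPsi_eq htI]
          exact mul_nonneg (h.coef_pos htI).le (by linarith [hall t htI])
      · exact h.Psi_nonneg_of hx (fun t ht => hall t ⟨ht.1, ht.2.trans hx.2⟩)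
    have hI : ξ0 / 2 ∈ Ioo 0 ξ0 := ⟨by linarith, by linarith⟩
    refine ⟨ξ0 / 2, hI, ?_⟩
    have h1 := h.dPsi hI
    have h2 : HasDerivAt (Psi n β f W) 0 (ξ0 / 2) := by
      refine (hasDerivAt_const (ξ0 / 2) (0:ℝ)).congr_of_eventuallyEq ?_
      filter_upwards [Ioo_mem_nhds hI.1 hI.2] with y hy using hz y hy
    have h3 := h1.unique h2
    rw [h.dPsi_eq hI] at h3
    rcases mul_eq_zero.1 h3 with h4 | h4
    · exact absurd h4 (h.coef_pos hI).ne'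
    · linarith
  · push Not at hall
    obtain ⟨y, hy, hQy⟩ := hall
    have hQp := h.Q_pos hy
    set k := 1 / Q n p σ α β f y with hk
    have hk1 : 1 ≤ k := by rw [hk, le_div_iff₀ hQp]; linarith
    have hkb : 1 ≤ k ^ β := Real.one_le_rpow hk1 hβ.le
    have hkb0 : 0 < k ^ β := by linarith
    have hy0 := hy.1
    have hx0 : 0 < y / k ^ β := by positivity
    have hxy : y / k ^ β ≤ y := div_le_self hy.1.le hkb
    have h1 := h.Q_mono hx0 hxy hy.2
    have e1 : y / (y / k ^ β) = k ^ β := by field_simp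
    rw [e1, ← Real.rpow_mul (by linarith), mul_one_div_cancel hβ.ne', Real.rpow_one, hk,
      mul_one_div_cancel hQp.ne'] at h1
    have hc : ContinuousOn (Q n p σ α β f) (Icc (y / k ^ β) y) := by
      intro t ht
      have htI : t ∈ Ioo 0 ξ0 := ⟨hx0.trans_le ht.1, ht.2.trans_lt hy.2⟩
      have c1 : ContinuousAt (fun t => f t ^ (1 - p)) t :=
        (h.df t htI).continuousAt.rpow_const (Or.inl (h.pos t htI).ne')
      have c2 : ContinuousAt (fun t : ℝ => t ^ (-σ)) t :=
        Real.continuousAt_rpow_const t _ (Or.inl htI.1.ne')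
      exact ((continuousAt_const.mul c1).mul c2).continuousWithinAt
    obtain ⟨s, hs, hs1⟩ := intermediate_value_Icc' hxy hc ⟨hQy.le, h1⟩
    exact ⟨s, ⟨hx0.trans_le hs.1, hs.2.trans_lt hy.2⟩, hs1⟩

theorem Psi_anti (h : Core n m p σ a α β ξ0 f f1 W W1) {s x y : ℝ} (hs : s ∈ Ioo 0 ξ0)
    (hQ : Q n p σ α β f s = 1) (hsx : s ≤ x) (hxy : x ≤ y) (hy : y < ξ0) :
    Psi n β f W y ≤ Psi n β f W x := by
  have := mono_aux (F := fun t => -Psi n β f W t)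
    (F' := fun t => -(t ^ (n - 1) * ((α + n * β) * f t - t ^ σ * f t ^ p))) hxy
    (fun t ht => (h.dPsi ⟨(hs.1.trans_le hsx).trans_le ht.1, ht.2.trans_lt hy⟩).neg) ?_
  · simpa using this
  · intro t ht
    have htI : t ∈ Ioo 0 ξ0 := ⟨(hs.1.trans_le hsx).trans ht.1, ht.2.trans hy⟩
    have h1 := h.Q_anti hs.1 (hsx.trans ht.1.le) htI.2
    rw [h.dPsi_eq htI, neg_nonneg]
    exact mul_nonpos_of_nonneg_of_nonpos (h.coef_pos htI).le (by linarith)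

theorem Psi_nonneg (h : Core n m p σ a α β ξ0 f f1 W W1) {x : ℝ} (hx : x ∈ Ioo 0 ξ0) :
    0 ≤ Psi n β f W x := by
  obtain ⟨s, hs, hQ⟩ := h.exists_star
  rcases le_total x s with hxs | hxs
  · apply h.Psi_nonneg_of hx
    intro t ht
    rw [← hQ]
    exact h.Q_anti ht.1 (ht.2.le.trans hxs) hs.2
  · apply le_of_tendsto h.Psi_end
    filter_upwards [Ioo_mem_nhdsLT hx.2] with y hy
    exact h.Psi_anti hs hQ hxs hy.1.le hy.2

theorem vmono (h : Core n m p σ a α β ξ0 f f1 W W1) {x y : ℝ} (hx : 0 < x) (hxy : x ≤ y)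
    (hy : y < ξ0) : f x ^ (m - 1) + (m - 1) * β / (2 * m) * x ^ 2 ≤
      f y ^ (m - 1) + (m - 1) * β / (2 * m) * y ^ 2 := by
  apply mono_aux (F := fun t => f t ^ (m - 1) + (m - 1) * β / (2 * m) * t ^ 2)
    (F' := fun t => (m - 1) * f t ^ (m - 2) * f1 t + 2 * ((m - 1) * β / (2 * m)) * t) hxy
  · intro t ht
    have htI : t ∈ Ioo 0 ξ0 := ⟨hx.trans_le ht.1, ht.2.trans_lt hy⟩
    have h1 := (h.du htI).add ((hasDerivAt_pow 2 t).const_mul ((m - 1) * β / (2 * m)))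
    refine h1.congr_deriv ?_
    push_cast; ring
  · intro t ht
    have htI : t ∈ Ioo 0 ξ0 := ⟨hx.trans ht.1, ht.2.trans hy⟩
    have h1 := h.Psi_nonneg htI
    rw [h.Psi_eq htI] at h1
    have hm := h.hm
    have h2 : 0 < m - 1 := by linarith
    have := Real.rpow_pos_of_pos htI.1 (n - 1)
    have := h.pos t htI
    exact nonneg_of_mul_nonneg_right h1 (by positivity)

theorem f_eq (h : Core n m p σ a α β ξ0 f f1 W W1) {x : ℝ} (hx : x ∈ Ioo 0 ξ0) :
    f x = (f x ^ (m - 1)) ^ (1 / (m - 1)) := by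
  have := h.hm
  rw [← Real.rpow_mul (h.pos x hx).le, mul_one_div_cancel (by linarith), Real.rpow_one]

theorem u_lower (h : Core n m p σ a α β ξ0 f f1 W W1)
    (hb : β ≤ 1 / (192 * ((m - 1) * n + 2))) {s : ℝ} (hs : s ∈ Ioo 0 ξ0)
    (hQ : Q n p σ α β f s = 1) {x : ℝ} (hx : 0 < x) (hxs : x ≤ s / 2) :
    (m - 1) / (8 * m * ((m - 1) * n + 2)) * x ^ 2 ≤ f x ^ (m - 1) := by
  have hm := h.hm
  have hm1 : 0 < m - 1 := by linarith
  have hn := h.hn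
  have hβ := h.hβ
  have hD : 2 ≤ (m - 1) * n + 2 := by nlinarith
  set D := (m - 1) * n + 2 with hDdef
  have hD0 : 0 < D := by linarith
  set c := (m - 1) / (8 * m * D) with hc
  have hc0 : 0 < c := by positivity
  by_contra! hlt
  obtain ⟨r, hr, hrI⟩ := mem_nhdsGT_iff_exists_Ioo_subset.1 h.u0
  have hr : 0 < r := hr
  have hxξ : x < ξ0 := by have := hs.1; have := hs.2; linarith
  have hrx : r ≤ x := by
    by_contra! hcon
    have : c * x ^ 2 < f x ^ (m - 1) := hrI ⟨hx, hcon⟩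
    linarith
  have hcont : ContinuousOn (fun t => f t ^ (m - 1) - c * t ^ 2) (Icc (r / 2) x) := by
    intro t ht
    have htI : t ∈ Ioo 0 ξ0 := ⟨by linarith [ht.1], ht.2.trans_lt hxξ⟩
    exact ((h.du htI).continuousAt.sub (by fun_prop)).continuousWithinAt
  have hcomp : IsCompact (Icc (r / 2) x ∩ (fun t => f t ^ (m - 1) - c * t ^ 2) ⁻¹' Iic 0) :=
    isCompact_Icc.of_isClosed_subset (hcont.preimage_isClosed_of_isClosed isClosed_Icc isClosed_Iic)
      inter_subset_left
  obtain ⟨t, ⟨htm, ht0⟩, htl⟩ := hcomp.exists_isLeast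
    ⟨x, ⟨by linarith, le_refl x⟩, by simp only [mem_preimage, mem_Iic]; linarith⟩
  simp only [mem_preimage, mem_Iic] at ht0
  have htp : 0 < t := by linarith [htm.1]
  have htx := htm.2
  have htI : t ∈ Ioo 0 ξ0 := ⟨htp, htx.trans_lt hxξ⟩
  have hbelow : ∀ y ∈ Ioo 0 t, c * y ^ 2 < f y ^ (m - 1) := by
    intro y hy
    rcases lt_or_ge y r with h1 | h1
    · exact hrI ⟨hy.1, h1⟩
    · by_contra! hcon
      have := htl ⟨⟨by linarith, hy.2.le.trans htx⟩, by
        simp only [mem_preimage, mem_Iic]; linarith⟩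
      linarith [hy.2]
  -- derivative at t
  have hder : (m - 1) * f t ^ (m - 2) * f1 t ≤ 2 * c * t := by
    have h1 := (h.du htI).sub ((hasDerivAt_pow 2 t).const_mul c)
    have hsl := (hasDerivAt_iff_tendsto_slope.1 h1).mono_left
      (nhdsWithin_mono t (fun y (hy : y ∈ Iio t) => ne_of_lt hy))
    have : (m - 1) * f t ^ (m - 2) * f1 t - c * (((2:ℕ):ℝ) * t ^ (2 - 1)) ≤ 0 := by
      apply le_of_tendsto hsl
      filter_upwards [Ioo_mem_nhdsLT htp] with y hy
      rw [slope_def_field]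
      apply div_nonpos_of_nonneg_of_nonpos
      · have := hbelow y hy
        simp only [Pi.sub_apply]
        linarith
      · linarith [hy.2]
    norm_num at this
    linarith
  set k := 1 / (m - 1) with hk
  have hk0 : 0 < k := by positivity
  have hap := h.ap_pos
  have sqk : ∀ y : ℝ, 0 < y → (c * y ^ 2) ^ k = c ^ k * y ^ (2 * k) := by
    intro y hy
    rw [Real.mul_rpow hc0.le (by positivity), ← Real.rpow_natCast y 2, ← Real.rpow_mul hy.le]
    norm_num
  set A := (α + n * β) * c ^ k / 2 with hA
  have hck := Real.rpow_pos_of_pos hc0 k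
  have hnk : 0 < n + 2 * k := by linarith
  have hge : A / (n + 2 * k) * t ^ (n + 2 * k) ≤ Psi n β f W t := by
    apply h.Psi_ge (G := fun t => A / (n + 2 * k) * t ^ (n + 2 * k))
      (G' := fun t => A * t ^ (n + 2 * k - 1)) htI
    · intro y hy
      have := (Real.hasDerivAt_rpow_const (x := y) (p := n + 2 * k) (Or.inl hy.1.ne')).const_mul
        (A / (n + 2 * k))
      refine this.congr_deriv ?_
      field_simp
    · intro y hy
      have hyI : y ∈ Ioo 0 ξ0 := ⟨hy.1, hy.2.trans htI.2⟩
      have hys : y ≤ s / 2 := hy.2.le.trans (htx.trans hxs)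
      have hy0 := hy.1
      have hf : c ^ k * y ^ (2 * k) ≤ f y := by
        rw [h.f_eq hyI, ← sqk y hy.1]
        exact Real.rpow_le_rpow (by positivity) (hbelow y hy).le hk0.le
      have hQ2 : 2 ≤ Q n p σ α β f y := by
        have h1 := h.Q_mono hy.1 (show y ≤ s by linarith [hs.1]) hs.2
        rw [hQ, one_mul] at h1
        refine le_trans ?_ h1
        have h2 : (2:ℝ) ≤ s / y := by rw [le_div_iff₀ hy.1]; linarith
        have h3 : (1:ℝ) ≤ 1 / β := by
          rw [le_div_iff₀ hβ]
          have : 1 / (192 * D) ≤ 1 := by rw [div_le_one (by positivity)]; linarith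
          linarith
        calc (2:ℝ) = 2 ^ (1:ℝ) := by simp
          _ ≤ 2 ^ (1 / β) := Real.rpow_le_rpow_of_exponent_le (by norm_num) h3
          _ ≤ _ := Real.rpow_le_rpow (by norm_num) h2 (by linarith)
      have hrel := h.Q_rel hyI
      have hR : 0 < y ^ σ * f y ^ p :=
        mul_pos (Real.rpow_pos_of_pos hy.1 _) (Real.rpow_pos_of_pos (h.pos y hyI) _)
      have h4 : A * y ^ (2 * k) ≤ (α + n * β) * f y - y ^ σ * f y ^ p := by
        have h5 : y ^ σ * f y ^ p ≤ (α + n * β) * f y / 2 := by nlinarith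
        have h6 : A * y ^ (2 * k) ≤ (α + n * β) * f y / 2 := by
          have : (α + n * β) * (c ^ k * y ^ (2 * k)) ≤ (α + n * β) * f y := by gcongr
          rw [hA]; linarith
        linarith
      have h7 : y ^ (n + 2 * k - 1) = y ^ (n - 1) * y ^ (2 * k) := by
        rw [← Real.rpow_add hy.1]; congr 1; ring
      rw [h7]
      have := mul_le_mul_of_nonneg_left h4 (Real.rpow_pos_of_pos hy.1 (n - 1)).le
      linarith
    · have h1 : Tendsto (fun y : ℝ => y ^ (n + 2 * k)) (𝓝[>] 0) (𝓝 0) := by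
        have := (Real.continuousAt_rpow_const 0 (n + 2 * k) (Or.inr hnk.le)).tendsto
        rw [Real.zero_rpow hnk.ne'] at this
        exact this.mono_left nhdsWithin_le_nhds
      simpa using h1.const_mul (A / (n + 2 * k))
  rw [h.Psi_eq htI] at hge
  have hft := h.pos t htI
  have hfle : f t ≤ c ^ k * t ^ (2 * k) := by
    rw [h.f_eq htI, ← sqk t htp]
    exact Real.rpow_le_rpow (Real.rpow_pos_of_pos hft _).le (by linarith) hk0.le
  have hT := Real.rpow_pos_of_pos htp (n - 1)
  have hT2 := Real.rpow_pos_of_pos htp (2 * k)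
  have e1 : t ^ (n + 2 * k) = t ^ (n - 1) * t ^ (2 * k) * t := by
    rw [← Real.rpow_add htp, ← Real.rpow_add_one htp.ne']; congr 1; ring
  have hup : t ^ (n - 1) * f t * (m / (m - 1)) *
      ((m - 1) * f t ^ (m - 2) * f1 t + 2 * ((m - 1) * β / (2 * m)) * t) ≤
      t ^ (n - 1) * (c ^ k * t ^ (2 * k)) * (m / (m - 1)) *
      ((2 * c + 2 * ((m - 1) * β / (2 * m))) * t) := by
    calc _ ≤ t ^ (n - 1) * f t * (m / (m - 1)) *
      ((2 * c + 2 * ((m - 1) * β / (2 * m))) * t) := by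
          apply mul_le_mul_of_nonneg_left _ (by positivity)
          linarith
      _ ≤ _ := by gcongr
  have hfin := hge.trans hup
  have e2 : t ^ (n - 1) * (c ^ k * t ^ (2 * k)) * (m / (m - 1)) *
      ((2 * c + 2 * ((m - 1) * β / (2 * m))) * t) =
      (1 / (4 * D) + β) * (c ^ k * t ^ (n + 2 * k)) := by
    rw [e1, hc]; field_simp; ring
  have e3 : n + 2 * k = D / (m - 1) := by rw [hk, hDdef]; field_simp
  have e4 : A / (n + 2 * k) * t ^ (n + 2 * k) = ((α + n * β) * (m - 1) / (2 * D)) *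
      (c ^ k * t ^ (n + 2 * k)) := by
    rw [hA]
    generalize t ^ (n + 2 * k) = Z
    rw [e3]; field_simp
  rw [e2, e4] at hfin
  have hZ : 0 < c ^ k * t ^ (n + 2 * k) := mul_pos hck (Real.rpow_pos_of_pos htp _)
  have hf2 := le_of_mul_le_mul_right hfin hZ
  have h8 : 1 ≤ (α + n * β) * (m - 1) := by
    have := h.hα1
    rw [div_le_iff₀ hm1] at this
    have : 0 ≤ n * β * (m - 1) := by positivity
    linarith
  have h9 : 1 / (2 * D) ≤ (α + n * β) * (m - 1) / (2 * D) := by gcongr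
  have h10 : 1 / (2 * D) = 1 / D / 2 := by field_simp
  have h11 : 1 / (4 * D) = 1 / D / 4 := by field_simp
  have h12 : 1 / (192 * D) = 1 / D / 192 := by field_simp
  have h13 : 0 < 1 / D := by positivity
  linarith

set_option maxHeartbeats 1600000 in
theorem main (h : Core n m p σ a α β ξ0 f f1 W W1)
    (hb : β ≤ 1 / (192 * ((m - 1) * n + 2))) (hσ0 : 0 < σ)
    (hσ : 4 * (2 ^ (1 / (m - 1)) * 2 ^ (p / (m - 1))) < (3 / 2 : ℝ) ^ σ) : False := by
  obtain ⟨s, hs, hQ⟩ := h.exists_star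
  have hs0 := hs.1
  have hm := h.hm
  have hm1 : 0 < m - 1 := by linarith
  have hn := h.hn
  have hβ := h.hβ
  have hap := h.ap_pos
  have hD : 2 ≤ (m - 1) * n + 2 := by nlinarith
  have hlow := h.u_lower hb hs hQ (x := s / 2) (by linarith) le_rfl
  have hv1 := h.vmono (x := s / 2) (y := s) (by linarith) (by linarith) hs.2
  set D := (m - 1) * n + 2 with hDdef
  have hD0 : 0 < D := by linarith
  set c := (m - 1) / (8 * m * D) with hc
  have hc0 : 0 < c := by positivity
  set b := (m - 1) * β / (2 * m) with hbdef
  have hb0 : 0 < b := by positivity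
  have hbc : b ≤ c / 48 := by
    have h1 : b ≤ (m - 1) * (1 / (192 * D)) / (2 * m) := by rw [hbdef]; gcongr
    have h2 : (m - 1) * (1 / (192 * D)) / (2 * m) = c / 48 := by rw [hc]; field_simp; norm_num
    linarith
  have hs2 : 0 < s ^ 2 := by positivity
  have hbc2 : b * s ^ 2 ≤ c / 48 * s ^ 2 := by gcongr
  set U := f s ^ (m - 1) with hU
  have hUl : c / 8 * s ^ 2 ≤ U := by nlinarith
  have hU0 : 0 < U := Real.rpow_pos_of_pos (h.pos s hs) _
  -- the interface is beyond 2 s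
  have h2s : 2 * s < ξ0 := by
    by_contra! hcon
    have hlim : Tendsto (fun x => f x ^ (m - 1) + b * x ^ 2) (𝓝[<] ξ0) (𝓝 (0 + b * ξ0 ^ 2)) := by
      apply Tendsto.add
      · have := h.fend.rpow_const (p := m - 1) (Or.inr hm1.le)
        rwa [Real.zero_rpow hm1.ne'] at this
      · exact ((by fun_prop : Continuous fun x : ℝ => b * x ^ 2).tendsto ξ0).mono_left
          nhdsWithin_le_nhds
    have h1 : U + b * s ^ 2 ≤ 0 + b * ξ0 ^ 2 := by
      apply ge_of_tendsto hlim
      filter_upwards [Ioo_mem_nhdsLT hs.2] with y hy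
      exact h.vmono hs.1 hy.1.le hy.2
    have h3 : ξ0 ^ 2 ≤ 4 * s ^ 2 := by have := h.hξ0; nlinarith
    have h4 : b * ξ0 ^ 2 ≤ b * (4 * s ^ 2) := by gcongr
    nlinarith
  set k := 1 / (m - 1) with hk
  have hk0 : 0 < k := by positivity
  have hfs := h.pos s hs
  -- upper bound for f before s
  have hup : ∀ x ∈ Ioo 0 s, f x ≤ 2 ^ k * f s := by
    intro x hx
    have h1 := h.vmono hx.1 hx.2.le hs.2
    have hxI : x ∈ Ioo 0 ξ0 := ⟨hx.1, hx.2.trans hs.2⟩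
    have h2 : f x ^ (m - 1) ≤ 2 * U := by
      have : 0 ≤ b * x ^ 2 := by positivity
      nlinarith
    rw [h.f_eq hxI, h.f_eq hs, ← Real.mul_rpow (by norm_num) hU0.le]
    exact Real.rpow_le_rpow (Real.rpow_pos_of_pos (h.pos x hxI) _).le h2 hk0.le
  -- lower bound for f after s
  have hdn : ∀ x, s ≤ x → x ≤ 2 * s → f s ≤ 2 ^ k * f x := by
    intro x hx hx2
    have hxI : x ∈ Ioo 0 ξ0 := ⟨hs0.trans_le hx, by linarith⟩
    have h1 := h.vmono hs0 hx hxI.2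
    have hux := Real.rpow_pos_of_pos (h.pos x hxI) (m - 1)
    have h2 : U ≤ 2 * f x ^ (m - 1) := by
      have h3 : x ^ 2 ≤ 4 * s ^ 2 := by nlinarith
      have h4 : b * x ^ 2 ≤ b * (4 * s ^ 2) := by gcongr
      nlinarith
    rw [h.f_eq hxI, h.f_eq hs, ← Real.mul_rpow (by norm_num) hux.le]
    exact Real.rpow_le_rpow hU0.le h2 hk0.le
  -- upper bound for Psi s
  have hPs : Psi n β f W s ≤ (α + n * β) * (2 ^ k * f s) / n * s ^ n := by
    apply h.Psi_le (G := fun t => (α + n * β) * (2 ^ k * f s) / n * t ^ n)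
      (G' := fun t => (α + n * β) * (2 ^ k * f s) * t ^ (n - 1)) hs
    · intro y hy
      have := (Real.hasDerivAt_rpow_const (x := y) (p := n) (Or.inl hy.1.ne')).const_mul
        ((α + n * β) * (2 ^ k * f s) / n)
      refine this.congr_deriv ?_
      field_simp
    · intro y hy
      have hyI : y ∈ Ioo 0 ξ0 := ⟨hy.1, hy.2.trans hs.2⟩
      have hR : 0 < y ^ σ * f y ^ p :=
        mul_pos (Real.rpow_pos_of_pos hy.1 _) (Real.rpow_pos_of_pos (h.pos y hyI) _)
      have h1 : (α + n * β) * f y ≤ (α + n * β) * (2 ^ k * f s) := by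
        gcongr; exact hup y hy
      have := mul_le_mul_of_nonneg_left (show (α + n * β) * f y - y ^ σ * f y ^ p ≤
        (α + n * β) * (2 ^ k * f s) by linarith) (Real.rpow_pos_of_pos hy.1 (n - 1)).le
      linarith
    · have hn0 : 0 < n := by linarith
      have h1 : Tendsto (fun y : ℝ => y ^ n) (𝓝[>] 0) (𝓝 0) := by
        have := (Real.continuousAt_rpow_const 0 n (Or.inr hn0.le)).tendsto
        rw [Real.zero_rpow hn0.ne'] at this
        exact this.mono_left nhdsWithin_le_nhds
      simpa using h1.const_mul ((α + n * β) * (2 ^ k * f s) / n)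
  -- decrease
  set q := p / (m - 1) with hq
  have h2k : (0:ℝ) < 2 ^ k := by positivity
  have h2q : (0:ℝ) < 2 ^ q := by positivity
  have h2kp : ((2:ℝ) ^ k) ^ p = 2 ^ q := by
    rw [← Real.rpow_mul (by norm_num), hk, hq]; congr 1; ring
  set E := s ^ (n - 1) * ((3 / 2) ^ σ * ((α + n * β) * f s) / 2 ^ q) / 2 with hE
  have hrels := h.Q_rel hs
  rw [hQ, mul_one] at hrels
  have hdec : Psi n β f W (2 * s) + E * (2 * s) ≤ Psi n β f W (3 / 2 * s) + E * (3 / 2 * s) := by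
    have := mono_aux (F := fun t => -(Psi n β f W t + E * t)) (x := 3 / 2 * s) (y := 2 * s)
      (F' := fun t => -(t ^ (n - 1) * ((α + n * β) * f t - t ^ σ * f t ^ p) + E * 1)) (by linarith)
      (fun t ht => ((h.dPsi ⟨by linarith [ht.1], by linarith [ht.2]⟩).add
        ((hasDerivAt_id t).const_mul E)).neg) ?_
    · linarith
    · intro t ht
      have htI : t ∈ Ioo 0 ξ0 := ⟨by linarith [ht.1], by linarith [ht.2]⟩
      have ht0 := htI.1
      have hst : s ≤ t := by linarith [ht.1]
      have hQt : Q n p σ α β f t ≤ 1 / 2 := by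
        have h1 := h.Q_mono hs0 hst htI.2
        rw [hQ] at h1
        have h2 : (3 / 2:ℝ) ≤ t / s := by rw [le_div_iff₀ hs0]; linarith [ht.1]
        have h3 : (2:ℝ) ≤ 1 / β := by
          rw [le_div_iff₀ hβ]
          have : 1 / (192 * D) ≤ 1 / 2 := by
            rw [div_le_div_iff₀ (by positivity) (by norm_num)]; linarith
          linarith
        have h4 : (2:ℝ) ≤ (t / s) ^ (1 / β) := by
          calc (2:ℝ) ≤ (3 / 2) ^ (2:ℝ) := by norm_num
            _ ≤ (3 / 2) ^ (1 / β) := Real.rpow_le_rpow_of_exponent_le (by norm_num) h3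
            _ ≤ _ := Real.rpow_le_rpow (by norm_num) h2 (by linarith)
        have := h.Q_pos htI
        nlinarith
      rw [h.dPsi_eq htI, neg_nonneg]
      have hcp := h.coef_pos htI
      have h5 : 2 * E ≤ t ^ (n - 1) * (t ^ σ * f t ^ p) := by
        have a1 : s ^ (n - 1) ≤ t ^ (n - 1) := Real.rpow_le_rpow hs0.le hst (by linarith)
        have a2 : (3 / 2) ^ σ * s ^ σ ≤ t ^ σ := by
          rw [← Real.mul_rpow (by norm_num) hs0.le]
          exact Real.rpow_le_rpow (by positivity) ht.1.le hσ0.le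
        have a3 : f s ^ p ≤ 2 ^ q * f t ^ p := by
          rw [← h2kp, ← Real.mul_rpow h2k.le (h.pos t htI).le]
          exact Real.rpow_le_rpow hfs.le (hdn t hst ht.2.le) h.hp0.le
        have a4 : f s ^ p / 2 ^ q ≤ f t ^ p := by
          rw [div_le_iff₀ h2q]; linarith
        have e : 2 * E = s ^ (n - 1) * (((3 / 2) ^ σ * s ^ σ) * (f s ^ p / 2 ^ q)) := by
          rw [hE, ← hrels]; ring
        rw [e]
        have := Real.rpow_pos_of_pos hs0 (n - 1)
        have := Real.rpow_pos_of_pos hs0 σ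
        have := Real.rpow_pos_of_pos hfs p
        have := Real.rpow_pos_of_pos ht0 (n - 1)
        have := Real.rpow_pos_of_pos ht0 σ
        gcongr
      nlinarith
  have hanti := h.Psi_anti hs hQ (x := s) (y := 3 / 2 * s) le_rfl (by linarith) (by linarith)
  have hfinal := h.Psi_nonneg (x := 2 * s) ⟨by linarith, h2s⟩
  have hsn : s ^ n = s ^ (n - 1) * s := by
    rw [← Real.rpow_add_one hs0.ne']; congr 1; ring
  have hsn0 : 0 < s ^ n := Real.rpow_pos_of_pos hs0 n
  have hlow2 : E * (s / 2) = (α + n * β) * f s * s ^ n * ((3 / 2) ^ σ / 2 ^ q / 4) := by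
    rw [hE, hsn]; ring
  have hPs2 : (α + n * β) * (2 ^ k * f s) / n * s ^ n ≤ (α + n * β) * f s * s ^ n * 2 ^ k := by
    have : (α + n * β) * (2 ^ k * f s) / n ≤ (α + n * β) * (2 ^ k * f s) :=
      div_le_self (by positivity) hn
    calc _ ≤ (α + n * β) * (2 ^ k * f s) * s ^ n := by gcongr
      _ = _ := by ring
  have hbig : 2 ^ k < (3 / 2:ℝ) ^ σ / 2 ^ q / 4 := by
    rw [lt_div_iff₀ (by norm_num), lt_div_iff₀ h2q]; linarith
  have hpos : 0 < (α + n * β) * f s * s ^ n := by positivity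
  have := mul_lt_mul_of_pos_left hbig hpos
  linarith

end Core

theorem build_core (N : ℕ) (m p σ : ℝ) (f : ℝ → ℝ) (ξ0 : ℝ) (hm : 1 < m) (hp0 : 0 < p)
    (hp1 : p < 1) (hN : 1 ≤ N) (hL : 0 < σ * (m - 1) + 2 * (p - 1))
    (hP : ProfileWithInterface N m p σ f ξ0)
    (g0 : Tendsto (fun x => f x * x ^ (-((σ + 2) / (m - p)))) (𝓝[>] 0) atTop)
    (u0 : ∀ᶠ x in 𝓝[>] (0:ℝ),
      (m - 1) / (8 * m * ((m - 1) * (N : ℝ) + 2)) * x ^ 2 < f x ^ (m - 1))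
    (w0 : Tendsto (fun x => (f x ^ m - f 0 ^ m) / x) (𝓝[>] 0) (𝓝 0)) :
    Core (N : ℝ) m p σ ((σ + 2) / (m - p)) (alphaC m p σ) (betaC m p σ) ξ0 f (deriv f)
      (deriv fun x => f x ^ m) (deriv (deriv fun x => f x ^ m)) := by
  obtain ⟨hξ, hc, hpos, hcd, hode, hf0, hW⟩ := hP
  have hm1 : 0 < m - 1 := by linarith
  have hmp : 0 < m - p := by linarith
  have hdf : ∀ x ∈ Ioo 0 ξ0, HasDerivAt f (deriv f x) x := fun x hx =>
    ((hcd.differentiableOn (by norm_num)).differentiableAt (Ioo_mem_nhds hx.1 hx.2)).hasDerivAt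
  have hcw : ContDiffOn ℝ 2 (fun x => f x ^ m) (Ioo 0 ξ0) :=
    hcd.rpow_const_of_ne (fun x hx => (hpos x hx).ne')
  have hdw : ∀ x ∈ Ioo 0 ξ0, HasDerivAt (fun x => f x ^ m) (m * f x ^ (m - 1) * deriv f x) x := by
    intro x hx
    refine ((hdf x hx).rpow_const (p := m) (Or.inl (hpos x hx).ne')).congr_deriv ?_
    ring
  refine
    { hm := hm, hp0 := hp0, hp1 := hp1, hn := by exact_mod_cast hN
      hβ := div_pos hmp hL
      hα := by unfold alphaC betaC; field_simp
      hα1 := ?_, ha := ?_, haB := ?_, hξ0 := hξ, pos := hpos, df := hdf, dW := ?_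
      eqW := fun x hx => (hdw x hx).deriv
      ode := hode, fend := ?_, Wend := hW, g0 := g0, u0 := u0, W0 := ?_, f0 := ?_ }
  · unfold alphaC
    rw [div_le_div_iff₀ hm1 hL]; nlinarith
  · rw [div_lt_div_iff₀ hm1 hmp]; nlinarith
  · unfold betaC; field_simp; ring
  · intro x hx
    have h1 : ContDiffOn ℝ 1 (deriv fun x => f x ^ m) (Ioo 0 ξ0) :=
      hcw.deriv_of_isOpen isOpen_Ioo (by norm_num)
    exact ((h1.differentiableOn (by norm_num)).differentiableAt
      (Ioo_mem_nhds hx.1 hx.2)).hasDerivAt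
  · have h1 := (hc ξ0 (right_mem_Icc.2 hξ.le)).tendsto
    rw [hf0] at h1
    refine h1.mono_left ?_
    rw [← nhdsWithin_Ioo_eq_nhdsLT hξ]
    exact nhdsWithin_mono _ Ioo_subset_Icc_self
  · intro ε hε δ hδ
    have h1 := w0.eventually (Metric.ball_mem_nhds (0:ℝ) hε)
    have h2 : Ioo 0 (min δ ξ0) ∈ 𝓝[>] (0:ℝ) := Ioo_mem_nhdsGT (lt_min hδ hξ)
    obtain ⟨x, hx, hxI⟩ := (h1.and h2).exists
    have hxδ : x < δ := hxI.2.trans_le (min_le_left _ _)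
    have hxξ : x < ξ0 := hxI.2.trans_le (min_le_right _ _)
    obtain ⟨y, hy, hye⟩ := exists_hasDerivAt_eq_slope (fun x => f x ^ m)
      (fun x => m * f x ^ (m - 1) * deriv f x) hxI.1
      ((hc.mono (Icc_subset_Icc le_rfl hxξ.le)).rpow_const (fun _ _ => Or.inr (by linarith)))
      (fun t ht => hdw t ⟨ht.1, ht.2.trans hxξ⟩)
    refine ⟨y, ⟨hy.1, hy.2.trans hxδ⟩, ?_⟩
    rw [(hdw y ⟨hy.1, hy.2.trans hxξ⟩).deriv, hye, sub_zero]
    rw [abs_div]; simpa using hx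
  · refine ⟨f 0 + 1, ?_⟩
    have h1 := (hc 0 (left_mem_Icc.2 hξ.le)).tendsto
    have h2 : Tendsto f (𝓝[>] 0) (𝓝 (f 0)) := by
      refine h1.mono_left ?_
      rw [← nhdsWithin_Ioo_eq_nhdsGT hξ]
      exact nhdsWithin_mono _ Ioo_subset_Icc_self
    exact (h2.eventually (gt_mem_nhds (by linarith : f 0 < f 0 + 1))).mono (fun x hx => hx.le)

theorem rpow_neg_atTop {a : ℝ} (ha : a < 0) :
    Tendsto (fun x : ℝ => x ^ a) (𝓝[>] 0) atTop := by
  have h1 := (tendsto_rpow_atTop (neg_pos.2 ha)).comp tendsto_inv_nhdsGT_zero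
  refine h1.congr' ?_
  filter_upwards [self_mem_nhdsWithin] with x hx
  simp only [Function.comp]
  rw [Real.inv_rpow (le_of_lt hx), Real.rpow_neg (le_of_lt hx), inv_inv]

theorem rpow_pos_zero {a : ℝ} (ha : 0 < a) :
    Tendsto (fun x : ℝ => x ^ a) (𝓝[>] 0) (𝓝 0) := by
  have := (Real.continuousAt_rpow_const 0 a (Or.inr ha.le)).tendsto
  rw [Real.zero_rpow ha.ne'] at this
  exact this.mono_left nhdsWithin_le_nhds

theorem core_of_B1 (N : ℕ) (m p σ : ℝ) (f : ℝ → ℝ) (ξ0 : ℝ) (hm : 1 < m) (hp0 : 0 < p)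
    (hp1 : p < 1) (hN : 1 ≤ N) (hσ : 0 < σ) (hL : 0 < σ * (m - 1) + 2 * (p - 1))
    (hP : ProfileWithInterface N m p σ f ξ0) (hB : BehB1 N m p σ f) :
    Core (N : ℝ) m p σ ((σ + 2) / (m - p)) (alphaC m p σ) (betaC m p σ) ξ0 f (deriv f)
      (deriv fun x => f x ^ m) (deriv (deriv fun x => f x ^ m)) := by
  have hm1 : 0 < m - 1 := by linarith
  have hmp : 0 < m - p := by linarith
  obtain ⟨hf0, hB⟩ := hB
  have hft : Tendsto f (𝓝[>] 0) (𝓝 (f 0)) := by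
    have h1 := (hP.2.1 0 (left_mem_Icc.2 hP.1.le)).tendsto
    refine h1.mono_left ?_
    rw [← nhdsWithin_Ioo_eq_nhdsGT hP.1]
    exact nhdsWithin_mono _ Ioo_subset_Icc_self
  apply build_core N m p σ f ξ0 hm hp0 hp1 hN hL hP
  · exact hft.pos_mul_atTop hf0 (rpow_neg_atTop (neg_neg_of_pos (by positivity)))
  · have h1 : Tendsto (fun x => f x ^ (m - 1)) (𝓝[>] 0) (𝓝 (f 0 ^ (m - 1))) :=
      hft.rpow_const (Or.inr hm1.le)
    have h2 : Tendsto (fun x : ℝ => (m - 1) / (8 * m * ((m - 1) * (N : ℝ) + 2)) * x ^ 2)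
        (𝓝[>] 0) (𝓝 0) := by
      have := ((by fun_prop : Continuous fun x : ℝ =>
        (m - 1) / (8 * m * ((m - 1) * (N : ℝ) + 2)) * x ^ 2).tendsto 0).mono_left
          (nhdsWithin_le_nhds (s := Ioi 0))
      simpa using this
    exact h2.eventually_lt h1 (Real.rpow_pos_of_pos hf0 _)
  · have hu : HasDerivWithinAt (fun x => f x ^ (m - 1)) 0 (Ioi 0) 0 := by
      rw [hasDerivWithinAt_iff_tendsto_slope' (by simp)]
      have hx : Tendsto (fun x : ℝ => x) (𝓝[>] 0) (𝓝 0) :=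
        tendsto_id.mono_left nhdsWithin_le_nhds
      have h1 := hB.mul hx
      rw [mul_zero] at h1
      refine h1.congr' ?_
      filter_upwards [self_mem_nhdsWithin] with x hx
      have hx : 0 < x := hx
      rw [slope_def_field, sub_zero]
      field_simp
    have hw := hu.rpow_const (p := m / (m - 1)) (Or.inl (Real.rpow_pos_of_pos hf0 _).ne')
    rw [hasDerivWithinAt_iff_tendsto_slope' (by simp)] at hw
    simp only [zero_mul] at hw
    refine hw.congr' ?_
    filter_upwards [Ioo_mem_nhdsGT hP.1] with x hx
    have e : (m - 1) * (m / (m - 1)) = m := by field_simp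
    rw [slope_def_field, sub_zero, ← Real.rpow_mul (hP.2.2.1 x hx).le, ← Real.rpow_mul hf0.le, e]

theorem core_of_B2 (N : ℕ) (m p σ : ℝ) (f : ℝ → ℝ) (ξ0 : ℝ) (hm : 1 < m) (hp0 : 0 < p)
    (hp1 : p < 1) (hN : 1 ≤ N) (hL : 0 < σ * (m - 1) + 2 * (p - 1))
    (hP : ProfileWithInterface N m p σ f ξ0) (hB : BehB2 N m f) :
    Core (N : ℝ) m p σ ((σ + 2) / (m - p)) (alphaC m p σ) (betaC m p σ) ξ0 f (deriv f)
      (deriv fun x => f x ^ m) (deriv (deriv fun x => f x ^ m)) := by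
  have hm1 : 0 < m - 1 := by linarith
  have hmp : 0 < m - p := by linarith
  have hN0 : (0:ℝ) ≤ N := Nat.cast_nonneg N
  have hD : 0 < (m - 1) * (N : ℝ) + 2 := by positivity
  obtain ⟨hf0, hB⟩ := hB
  have eD : m * (N : ℝ) - (N : ℝ) + 2 = (m - 1) * (N : ℝ) + 2 := by ring
  rw [eD] at hB
  have hB0 : 0 < (m - 1) / (2 * m * ((m - 1) * (N : ℝ) + 2)) := by positivity
  have hC0 := Real.rpow_pos_of_pos hB0 (1 / (m - 1))
  apply build_core N m p σ f ξ0 hm hp0 hp1 hN hL hP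
  · have ha : 2 / (m - 1) < (σ + 2) / (m - p) := by
      rw [div_lt_div_iff₀ hm1 hmp]; nlinarith
    have h1 := hB.pos_mul_atTop hC0
      (rpow_neg_atTop (a := 2 / (m - 1) - (σ + 2) / (m - p)) (by linarith))
    refine h1.congr' ?_
    filter_upwards [self_mem_nhdsWithin] with x hx
    rw [mul_assoc, ← Real.rpow_add hx]
    congr 2; ring
  · have h1 := hB.rpow_const (p := m - 1) (Or.inr hm1.le)
    rw [← Real.rpow_mul hB0.le, one_div_mul_cancel hm1.ne', Real.rpow_one] at h1
    have hlt : (m - 1) / (8 * m * ((m - 1) * (N : ℝ) + 2)) <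
        (m - 1) / (2 * m * ((m - 1) * (N : ℝ) + 2)) := by
      gcongr; norm_num
    filter_upwards [h1.eventually (lt_mem_nhds hlt), Ioo_mem_nhdsGT hP.1] with x hx hxI
    have hx0 := hxI.1
    have e : (f x * x ^ (-(2 / (m - 1)))) ^ (m - 1) = f x ^ (m - 1) / x ^ 2 := by
      rw [Real.mul_rpow (hP.2.2.1 x hxI).le (Real.rpow_pos_of_pos hx0 _).le,
        ← Real.rpow_mul hx0.le, show -(2 / (m - 1)) * (m - 1) = -((2:ℕ):ℝ) by push_cast; field_simp,
        Real.rpow_neg hx0.le, Real.rpow_natCast]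
      rfl
    rw [e, lt_div_iff₀ (by positivity)] at hx
    exact hx
  · have h1 := (hB.rpow_const (p := m) (Or.inr (by linarith))).mul
      (rpow_pos_zero (a := 2 / (m - 1) * m - 1) (by
        rw [sub_pos, div_mul_eq_mul_div, lt_div_iff₀ hm1]; linarith))
    rw [mul_zero] at h1
    refine h1.congr' ?_
    filter_upwards [Ioo_mem_nhdsGT hP.1] with x hxI
    have hx0 := hxI.1
    rw [hf0, Real.zero_rpow (by linarith), sub_zero,
      Real.mul_rpow (hP.2.2.1 x hxI).le (Real.rpow_pos_of_pos hx0 _).le,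
      ← Real.rpow_mul hx0.le, mul_assoc, ← Real.rpow_add hx0,
      show -(2 / (m - 1)) * m + (2 / (m - 1) * m - 1) = -1 by ring, Real.rpow_neg_one]
    rfl

theorem classification_sigma_large (m p : ℝ) (N : ℕ) (hm : 1 < m) (hp0 : 0 < p) (hp1 : p < 1) (hN : 1 ≤ N) :
    ∃ σ1 : ℝ, 2 * (1 - p) / (m - 1) ≤ σ1 ∧
      ∀ σ : ℝ, σ1 < σ →
        (∀ f : ℝ → ℝ, ∀ ξ0 : ℝ, GoodProfile N m p σ f ξ0 →
          ¬ (BehB1 N m p σ f ∨ BehB2 N m f)) ∧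
        (∀ f : ℝ → ℝ, ∀ ξ0 : ℝ, GoodProfile N m p σ f ξ0 → BehB3 m p σ f) := by
  have hm1 : 0 < m - 1 := by linarith
  have hD : 0 < (m - 1) * (N : ℝ) + 2 := by positivity
  have hLt : Tendsto (fun σ : ℝ => σ * (m - 1) + 2 * (p - 1)) atTop atTop :=
    tendsto_atTop_add_const_right _ _ (tendsto_id.atTop_mul_const hm1)
  have hβt : Tendsto (fun σ : ℝ => betaC m p σ) atTop (𝓝 0) :=
    hLt.const_div_atTop (m - p)
  have hexp : Tendsto (fun σ : ℝ => (3 / 2 : ℝ) ^ σ) atTop atTop :=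
    tendsto_rpow_atTop_of_base_gt_one (3 / 2) (by norm_num)
  have hev : ∀ᶠ σ : ℝ in atTop, 0 < σ ∧ 0 < σ * (m - 1) + 2 * (p - 1) ∧
      betaC m p σ ≤ 1 / (192 * ((m - 1) * (N : ℝ) + 2)) ∧
      4 * (2 ^ (1 / (m - 1)) * 2 ^ (p / (m - 1))) < (3 / 2 : ℝ) ^ σ := by
    filter_upwards [eventually_gt_atTop 0, hLt.eventually (eventually_gt_atTop 0),
      hβt.eventually (gt_mem_nhds (show 0 < 1 / (192 * ((m - 1) * (N : ℝ) + 2)) by positivity)),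
      hexp.eventually (eventually_gt_atTop _)] with σ h1 h2 h3 h4
    exact ⟨h1, h2, h3.le, h4⟩
  obtain ⟨s0, hs0⟩ := eventually_atTop.1 hev
  refine ⟨max s0 (2 * (1 - p) / (m - 1)), le_max_right _ _, fun σ hσ => ?_⟩
  obtain ⟨h1, h2, h3, h4⟩ := hs0 σ ((le_max_left _ _).trans hσ.le)
  have key : ∀ f : ℝ → ℝ, ∀ ξ0 : ℝ, GoodProfile N m p σ f ξ0 →
      ¬ (BehB1 N m p σ f ∨ BehB2 N m f) := by
    rintro f ξ0 hG (hB | hB)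
    · exact (core_of_B1 N m p σ f ξ0 hm hp0 hp1 hN h1 h2 hG.1 hB).main h3 h1 h4
    · exact (core_of_B2 N m p σ f ξ0 hm hp0 hp1 hN h2 hG.1 hB).main h3 h1 h4
  refine ⟨key, fun f ξ0 hG => ?_⟩
  rcases hG.2 with hB | hB | hB
  · exact absurd (Or.inl hB) (key f ξ0 hG)
  · exact absurd (Or.inr hB) (key f ξ0 hG)
  · exact hB
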